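/- arXiv:2311.00880 — 6 statements merged into one kernel-verified Lean document; each statement's English description precedes it below -/
import Mathlib

section
/- For any two policies π and π', any reward r : S×A → ℝ, any discount γ ∈ [0,1), and any state s: V_{π'}(s) = V_π(s) + Σ_{t=0}^∞ γ^t Σ_{s'} (M_{π'}^t)(s,s') Σ_a (π'(a|s') − π(a|s')) Q_π(s',a). (When π' is everywhere positive, the correction series equals E_{π'}[ Σ_{t=0}^∞ γ^t (1 − π(A_t|S_t)/π'(A_t|S_t)) Q_π(S_t,A_t) | S_0 = s ].) -/
open Finset

variable {S A : Type*} [Fintype S] [Fintype A] [DecidableEq S] [Nonempty S] [Nonempty A]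

/-- A transition kernel: nonnegative, rows summing to one. -/
def IsKernel (P : S → A → S → ℝ) : Prop :=
  (∀ s a s', 0 ≤ P s a s') ∧ (∀ s a, ∑ s' : S, P s a s' = 1)

/-- A (stationary, stochastic) policy. -/
def IsPolicy (π : S → A → ℝ) : Prop :=
  (∀ s a, 0 ≤ π s a) ∧ (∀ s : S, ∑ a : A, π s a = 1)

/-- The Bellman equations for discount `γ` and reward `r`: `(V, Q)` are the value and
action-value functions of `π` iff these hold. -/
def IsValueFun (P : S → A → S → ℝ) (π : S → A → ℝ) (r : S → A → ℝ) (γ : ℝ)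
    (V : S → ℝ) (Q : S → A → ℝ) : Prop :=
  (∀ s a, Q s a = r s a + γ * ∑ s' : S, P s a s' * V s') ∧
  (∀ s : S, V s = ∑ a : A, π s a * Q s a)

/-- The state-transition matrix induced by a policy. -/
noncomputable def Mmat (P : S → A → S → ℝ) (π : S → A → ℝ) : Matrix S S ℝ :=
  Matrix.of fun s s' => ∑ a : A, π s a * P s a s'

theorem Mmat_mulVec_apply (P : S → A → S → ℝ) (π : S → A → ℝ) (D : S → ℝ) (s : S) :
    (Mmat P π).mulVec D s = ∑ a : A, π s a * ∑ s' : S, P s a s' * D s' := by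
  simp only [Matrix.mulVec, dotProduct, Mmat, Matrix.of_apply, Finset.sum_mul, Finset.mul_sum]
  rw [Finset.sum_comm]
  simp only [mul_assoc]

theorem Mmat_pow_bound (P : S → A → S → ℝ) (hP : IsKernel P) (π : S → A → ℝ) (hπ : IsPolicy π)
    (D : S → ℝ) (C : ℝ) (hC : ∀ s, |D s| ≤ C) (t : ℕ) :
    ∀ s, |((Mmat P π) ^ t).mulVec D s| ≤ C := by
  induction t with
  | zero => simpa using hC
  | succ t ih =>
    intro s
    rw [pow_succ', ← Matrix.mulVec_mulVec, Mmat_mulVec_apply]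
    have h1 : ∀ a, |∑ s' : S, P s a s' * ((Mmat P π) ^ t).mulVec D s'| ≤ C := by
      intro a
      calc _ ≤ ∑ s' : S, |P s a s' * ((Mmat P π) ^ t).mulVec D s'| :=
            Finset.abs_sum_le_sum_abs _ _
        _ ≤ ∑ s' : S, P s a s' * C := by
            apply Finset.sum_le_sum
            intro s' _
            rw [abs_mul, abs_of_nonneg (hP.1 s a s')]
            exact mul_le_mul_of_nonneg_left (ih s') (hP.1 s a s')
        _ = C := by rw [← Finset.sum_mul, hP.2, one_mul]
    calc _ ≤ ∑ a : A, |π s a * ∑ s' : S, P s a s' * ((Mmat P π) ^ t).mulVec D s'| :=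
            Finset.abs_sum_le_sum_abs _ _
      _ ≤ ∑ a : A, π s a * C := by
            apply Finset.sum_le_sum
            intro a _
            rw [abs_mul, abs_of_nonneg (hπ.1 s a)]
            exact mul_le_mul_of_nonneg_left (h1 a) (hπ.1 s a)
      _ = C := by rw [← Finset.sum_mul, hπ.2, one_mul]

/-- Performance-difference identity:
`V_{π'}(s) = V_π(s) + Σ_{t=0}^∞ γ^t Σ_{s'} (M_{π'}^t)(s,s') Σ_a (π'(a|s') − π(a|s')) Q_π(s',a)`. -/
theorem performance_difference_Q
    (P : S → A → S → ℝ) (hP : IsKernel P)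
    (π π' : S → A → ℝ) (hπ : IsPolicy π) (hπ' : IsPolicy π')
    (r : S → A → ℝ) (γ : ℝ) (hγ0 : 0 ≤ γ) (hγ1 : γ < 1)
    (V : S → ℝ) (Q : S → A → ℝ) (hVQ : IsValueFun P π r γ V Q)
    (V' : S → ℝ) (Q' : S → A → ℝ) (hVQ' : IsValueFun P π' r γ V' Q')
    (s : S) :
    V' s = V s + ∑' t : ℕ, γ ^ t * ∑ s' : S, (Mmat P π' ^ t) s s' *
      ∑ a : A, (π' s' a - π s' a) * Q s' a := by
  set M := Mmat P π' with hM
  have hg : (fun s' => ∑ a : A, (π' s' a - π s' a) * Q s' a)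
      = (V' - V) - γ • M.mulVec (V' - V) := by
    funext x
    simp only [Pi.sub_apply, Pi.smul_apply, smul_eq_mul, hM]
    rw [Mmat_mulVec_apply, hVQ'.2 x, hVQ.2 x, Finset.mul_sum, ← Finset.sum_sub_distrib,
      ← Finset.sum_sub_distrib]
    refine Finset.sum_congr rfl fun a _ => ?_
    have e : ∑ s' : S, P x a s' * (V' - V) s'
        = ∑ s' : S, P x a s' * V' s' - ∑ s' : S, P x a s' * V s' := by
      rw [← Finset.sum_sub_distrib]
      exact Finset.sum_congr rfl fun _ _ => by simp [mul_sub]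
    rw [e, hVQ'.1 x a, hVQ.1 x a]
    ring
  set f : ℕ → ℝ := fun t => γ ^ t * (M ^ t).mulVec (V' - V) s with hf
  have hterm : ∀ t : ℕ, γ ^ t * ∑ s' : S, (M ^ t) s s' *
      ∑ a : A, (π' s' a - π s' a) * Q s' a = f t - f (t + 1) := by
    intro t
    have : ∑ s' : S, (M ^ t) s s' * ∑ a : A, (π' s' a - π s' a) * Q s' a
        = (M ^ t).mulVec (fun s' => ∑ a : A, (π' s' a - π s' a) * Q s' a) s := rfl
    rw [this, hg, Matrix.mulVec_sub, Matrix.mulVec_smul, Matrix.mulVec_mulVec, ← pow_succ]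
    simp only [hf, Pi.sub_apply, Pi.smul_apply, smul_eq_mul]
    ring
  have hfs : Summable f := by
    have hb := Mmat_pow_bound P hP π' hπ' (V' - V) (∑ x, |(V' - V) x|)
      (fun x => Finset.single_le_sum (f := fun x => |(V' - V) x|)
        (fun _ _ => abs_nonneg _) (Finset.mem_univ x))
    refine Summable.of_norm_bounded
      ((summable_geometric_of_lt_one hγ0 hγ1).mul_right (∑ x, |(V' - V) x|)) fun t => ?_
    rw [Real.norm_eq_abs, hf, abs_mul, abs_of_nonneg (pow_nonneg hγ0 t)]
    exact mul_le_mul_of_nonneg_left (hb t s) (pow_nonneg hγ0 t)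
  have h0 : f 0 = V' s - V s := by simp [hf]
  rw [tsum_congr hterm, hfs.tsum_sub ((summable_nat_add_iff 1).2 hfs), hfs.tsum_eq_zero_add, h0]
  ring
end

section
/- Let f : S → {0,1} be a safety indicator that is absorbing for P. Then for any two policies π and π' and any state s: V^c_{π',0}(s) = V^c_{π,0}(s) + Σ_{t=0}^{T−2} Σ_{s'} (M_{π'}^t)(s,s') Σ_a (π'(a|s') − π(a|s')) Q^c_{π,t}(s',a), where M_{π'}(s,s') = Σ_a π'(a|s) P(s'|s,a) and M_{π'}^t is its t-th matrix power. -/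
open Finset

variable {S A : Type*} [Fintype S] [Fintype A] [DecidableEq S] [Nonempty S] [Nonempty A]

/-- Expectation, over trajectories with `n` transitions (`n+1` states) starting at `s`,
of a function `g` of the trajectory: `E_π[g | S_0 = s]` as a finite sum. -/
noncomputable def trajExp (P : S → A → S → ℝ) (π : S → A → ℝ) (n : ℕ) (s : S)
    (g : (Fin (n+1) → S) → (Fin n → A) → ℝ) : ℝ :=
  ∑ σ : Fin (n+1) → S, ∑ α : Fin n → A,
    if σ 0 = s then
      (∏ t : Fin n,
        π (σ (Fin.castSucc t)) (α t) * P (σ (Fin.castSucc t)) (α t) (σ (Fin.succ t))) * g σ α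
    else 0

/-- Safety critic `V^c_{π}` with `n` remaining transitions:
`E_π[∏_{u} f(S_u) | S_0 = s]` over trajectories of `n` transitions. -/
noncomputable def Vc (f : S → ℝ) (P : S → A → S → ℝ) (π : S → A → ℝ) (n : ℕ) (s : S) : ℝ :=
  trajExp P π n s (fun σ _ => ∏ u : Fin (n+1), f (σ u))

/-- Safety critic `Q^c_{π}` with `n` remaining transitions and the first action fixed:
the conditional expectation `E_π[∏_{u} f(S_u) | S_0 = s, A_0 = a]`. -/
noncomputable def Qc (f : S → ℝ) (P : S → A → S → ℝ) (π : S → A → ℝ) :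
    ℕ → S → A → ℝ
  | 0, s, _ => f s
  | (n+1), s, a => f s * ∑ s' : S, P s a s' * Vc f P π n s'

theorem sum_cons_aux {B : Type*} [Fintype B] (n : ℕ) (F : (Fin (n+1) → B) → ℝ) :
    ∑ σ : Fin (n+1) → B, F σ = ∑ b : B, ∑ σ : Fin n → B, F (Fin.cons b σ) := by
  rw [← Fintype.sum_prod_type']
  exact (Fintype.sum_equiv (Fin.consEquiv (fun _ => B)) _ _ (fun x => rfl)).symm

theorem Vc_zero_aux (f : S → ℝ) (P : S → A → S → ℝ) (π : S → A → ℝ) (s : S) :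
    Vc f P π 0 s = f s := by
  unfold Vc trajExp
  rw [sum_cons_aux]
  simp

theorem Vc_succ_aux (f : S → ℝ) (P : S → A → S → ℝ) (π : S → A → ℝ) (n : ℕ) (s : S) :
    Vc f P π (n+1) s = f s * ∑ a : A, π s a * ∑ s' : S, P s a s' * Vc f P π n s' := by
  have h1 : Vc f P π (n+1) s = ∑ σ : Fin (n+1) → S, ∑ a : A, ∑ α : Fin n → A,
      f s * (π s a * (P s a (σ 0) * ((∏ t : Fin n,
        π (σ (Fin.castSucc t)) (α t) * P (σ (Fin.castSucc t)) (α t) (σ (Fin.succ t))) *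
          ∏ u : Fin (n+1), f (σ u)))) := by
    unfold Vc trajExp
    rw [sum_cons_aux, Finset.sum_eq_single s]
    · refine Finset.sum_congr rfl fun σ _ => ?_
      rw [sum_cons_aux]
      refine Finset.sum_congr rfl fun a _ => Finset.sum_congr rfl fun α _ => ?_
      beta_reduce
      rw [Fin.prod_univ_succ, Fin.prod_univ_succ (fun u : Fin (n+1+1) => f ((Fin.cons s σ : Fin (n+1+1) → S) u))]
      simp only [Fin.cons_zero, Fin.cons_succ, Fin.castSucc_zero, if_true,
        ← Fin.succ_castSucc]
      ring
    · intro b _ hb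
      simp [hb]
    · simp
  have h2 : ∀ a, ∑ s' : S, P s a s' * Vc f P π n s' = ∑ σ : Fin (n+1) → S, ∑ α : Fin n → A,
      P s a (σ 0) * ((∏ t : Fin n,
        π (σ (Fin.castSucc t)) (α t) * P (σ (Fin.castSucc t)) (α t) (σ (Fin.succ t))) *
          ∏ u : Fin (n+1), f (σ u)) := by
    intro a
    unfold Vc trajExp
    simp only [Finset.mul_sum]
    rw [Finset.sum_comm]
    refine Finset.sum_congr rfl fun σ _ => ?_
    rw [Finset.sum_comm]
    refine Finset.sum_congr rfl fun α _ => ?_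
    simp
  rw [h1, Finset.sum_comm]
  simp only [h2, Finset.mul_sum]

theorem Vc_of_zero_aux (f : S → ℝ) (P : S → A → S → ℝ) (π : S → A → ℝ) (n : ℕ) (s : S)
    (h : f s = 0) : Vc f P π n s = 0 := by
  cases n with
  | zero => rw [Vc_zero_aux, h]
  | succ n => rw [Vc_succ_aux, h, zero_mul]

theorem absorb_aux (P : S → A → S → ℝ) (hP : IsKernel P) (π : S → A → ℝ)
    (f : S → ℝ) (hf : ∀ s, f s = 0 ∨ f s = 1)
    (habs : ∀ s a s', 0 < P s a s' → f s' ≤ f s) (n : ℕ) (s : S) (a : A) :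
    f s * ∑ s' : S, P s a s' * Vc f P π n s' = ∑ s' : S, P s a s' * Vc f P π n s' := by
  rcases hf s with h | h
  · rw [h, zero_mul]
    symm
    refine Finset.sum_eq_zero fun s' _ => ?_
    rcases (hP.1 s a s').eq_or_lt with h0 | h0
    · rw [← h0, zero_mul]
    · have := habs s a s' h0
      rcases hf s' with h' | h'
      · rw [Vc_of_zero_aux _ _ _ _ _ h', mul_zero]
      · linarith
  · rw [h, one_mul]

theorem pd_aux (P : S → A → S → ℝ) (hP : IsKernel P) (π π' : S → A → ℝ)
    (f : S → ℝ) (hf : ∀ s, f s = 0 ∨ f s = 1)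
    (habs : ∀ s a s', 0 < P s a s' → f s' ≤ f s) (n : ℕ) : ∀ s : S,
    Vc f P π' n s = Vc f P π n s +
      ∑ t ∈ Finset.range n, ∑ s' : S, (Mmat P π' ^ t) s s' *
        ∑ a : A, (π' s' a - π s' a) * Qc f P π (n - t) s' a := by
  have hV : ∀ (ρ : S → A → ℝ) n s, Vc f P ρ (n+1) s =
      ∑ a : A, ρ s a * ∑ s' : S, P s a s' * Vc f P ρ n s' := by
    intro ρ n s
    rw [Vc_succ_aux, Finset.mul_sum]
    refine Finset.sum_congr rfl fun a _ => ?_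
    rw [mul_left_comm, absorb_aux P hP ρ f hf habs]
  induction n with
  | zero => intro s; simp [Vc_zero_aux]
  | succ n ih =>
    intro s
    have hM : ∀ g : S → ℝ, ∑ a, π' s a * ∑ s', P s a s' * g s' =
        ∑ s', Mmat P π' s s' * g s' := by
      intro g
      simp only [Mmat, Matrix.of_apply, Finset.mul_sum, Finset.sum_mul]
      rw [Finset.sum_comm]
      simp only [mul_assoc]
    have hfirst : ∑ s' : S, (Mmat P π' ^ 0) s s' *
        ∑ a : A, (π' s' a - π s' a) * Qc f P π (n + 1 - 0) s' a =
        (∑ s', Mmat P π' s s' * Vc f P π n s') - Vc f P π (n+1) s := by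
      rw [← hM, hV π]
      simp only [pow_zero, Matrix.one_apply, ite_mul, one_mul, zero_mul, Finset.sum_ite_eq,
        Finset.mem_univ, if_true, Nat.sub_zero, Qc, absorb_aux P hP π f hf habs, sub_mul,
        Finset.sum_sub_distrib]
    have hrest : ∑ t ∈ Finset.range n, ∑ s' : S, (Mmat P π' ^ (t+1)) s s' *
        ∑ a : A, (π' s' a - π s' a) * Qc f P π (n + 1 - (t+1)) s' a =
        ∑ r, Mmat P π' s r * ∑ t ∈ Finset.range n, ∑ s' : S, (Mmat P π' ^ t) r s' *
        ∑ a : A, (π' s' a - π s' a) * Qc f P π (n - t) s' a := by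
      simp only [Nat.add_sub_add_right]
      generalize hG : (fun t s' => ∑ a : A, (π' s' a - π s' a) * Qc f P π (n - t) s' a) = G
      have hG' : ∀ t s', ∑ a : A, (π' s' a - π s' a) * Qc f P π (n - t) s' a = G t s' := by
        intro t s'; rw [← hG]
      simp only [hG']
      simp only [Finset.mul_sum (Finset.range n)]
      rw [Finset.sum_comm (s := Finset.univ)]
      refine Finset.sum_congr rfl fun t _ => ?_
      simp only [pow_succ', Matrix.mul_apply, Finset.sum_mul, Finset.mul_sum]
      rw [Finset.sum_comm]
      simp only [mul_assoc]
    rw [Finset.sum_range_succ', hfirst, hrest, hV π', hM]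
    simp only [ih, mul_add, Finset.sum_add_distrib]
    ring

/-- Finite-horizon performance-difference identity for the safety critic of an
absorbing safety indicator:
`V^c_{π',0}(s) = V^c_{π,0}(s) + Σ_{t=0}^{T−2} Σ_{s'} (M_{π'}^t)(s,s') Σ_a (π'(a|s') − π(a|s')) Q^c_{π,t}(s',a)`. -/
theorem safety_critic_performance_difference
    (P : S → A → S → ℝ) (hP : IsKernel P)
    (π π' : S → A → ℝ) (hπ : IsPolicy π) (hπ' : IsPolicy π')
    (f : S → ℝ) (hf : ∀ s, f s = 0 ∨ f s = 1)
    (habs : ∀ s a s', 0 < P s a s' → f s' ≤ f s)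
    (T : ℕ) (hT : 2 ≤ T) (s : S) :
    Vc f P π' (T - 1) s = Vc f P π (T - 1) s +
      ∑ t ∈ Finset.range (T - 1), ∑ s' : S, (Mmat P π' ^ t) s s' *
        ∑ a : A, (π' s' a - π s' a) * Qc f P π (T - 1 - t) s' a := by
  exact pd_aux P hP π π' f hf habs (T - 1) s
end

section
/- Let π and π' be policies with π(a|s) > 0 for all s,a, let r : S×A → ℝ be a reward and γ ∈ [0,1). Set α = max_s (1/2) Σ_a |π'(a|s) − π(a|s)| (the maximal total-variation distance) and ε = max_{s,a} |(π'(a|s)/π(a|s) − 1) · A_π(s,a)|. Then for every state s: V_{π'}(s) ≥ V_π(s) + Σ_{t=0}^∞ γ^t Σ_{s'} (M_π^t)(s,s') Σ_a (π'(a|s') − π(a|s')) A_π(s',a) − 2αγε/(1−γ)². (The middle term is E_π[ Σ_t γ^t (π'(A_t|S_t)/π(A_t|S_t) − 1) A_π(S_t,A_t) | S_0 = s ], an expectation over trajectories sampled from the old policy π.) -/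
open Finset

variable {S A : Type*} [Fintype S] [Fintype A] [DecidableEq S] [Nonempty S] [Nonempty A]

lemma aux_avg {S : Type*} [Fintype S] (k f : S → ℝ) (C : ℝ) (hk : ∀ s, 0 ≤ k s)
    (hk1 : ∑ s, k s = 1) (hf : ∀ s, |f s| ≤ C) : |∑ s, k s * f s| ≤ C := by
  calc |∑ s, k s * f s| ≤ ∑ s, |k s * f s| := Finset.abs_sum_le_sum_abs _ _
    _ ≤ ∑ s, k s * C := by
        apply Finset.sum_le_sum
        intro s _
        rw [abs_mul, abs_of_nonneg (hk s)]
        exact mul_le_mul_of_nonneg_left (hf s) (hk s)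
    _ = C := by rw [← Finset.sum_mul, hk1, one_mul]

lemma aux_fix {S : Type*} [Fintype S] [Nonempty S] (K : S → S → ℝ) (E c : S → ℝ) (γ C : ℝ)
    (hγ0 : 0 ≤ γ) (hγ1 : γ < 1) (hk : ∀ s s', 0 ≤ K s s') (hk1 : ∀ s, ∑ s', K s s' = 1)
    (hE : ∀ s, E s = c s + γ * ∑ s', K s s' * E s') (hc : ∀ s, |c s| ≤ C) (s : S) :
    |E s| ≤ C / (1 - γ) := by
  obtain ⟨m, hm⟩ := Finite.exists_max (fun s => |E s|)
  refine (hm s).trans ?_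
  have h1 := aux_avg (K m) E _ (hk m) (hk1 m) hm
  have h2 : |E m| ≤ C + γ * |E m| := by
    calc |E m| = |c m + γ * ∑ s', K m s' * E s'| := by rw [← hE m]
      _ ≤ |c m| + |γ * ∑ s', K m s' * E s'| := abs_add_le _ _
      _ ≤ C + γ * |E m| := by
        rw [abs_mul, abs_of_nonneg hγ0]
        exact add_le_add (hc m) (mul_le_mul_of_nonneg_left h1 hγ0)
  rw [le_div_iff₀ (by linarith)]
  linarith

lemma aux_Msum {S A : Type*} [Fintype S] [Fintype A] (P : S → A → S → ℝ) (π : S → A → ℝ)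
    (f : S → ℝ) (s : S) :
    ∑ s', Mmat P π s s' * f s' = ∑ a, π s a * ∑ s', P s a s' * f s' := by
  simp only [Mmat, Matrix.of_apply, Finset.sum_mul, Finset.mul_sum]
  rw [Finset.sum_comm]
  simp only [mul_assoc]

/-- Trust-region lower bound (ratio form `π'/π − 1`, sampled from the old policy `π`):
`V_{π'}(s) ≥ V_π(s) + Σ_t γ^t Σ_{s'} (M_π^t)(s,s') Σ_a (π'(a|s') − π(a|s')) A_π(s',a)
  − 2αγε/(1−γ)²`. -/
theorem trust_region_lower_bound_ratio
    (P : S → A → S → ℝ) (hP : IsKernel P)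
    (π π' : S → A → ℝ) (hπ : IsPolicy π) (hπ' : IsPolicy π')
    (hpos : ∀ s a, 0 < π s a)
    (r : S → A → ℝ) (γ : ℝ) (hγ0 : 0 ≤ γ) (hγ1 : γ < 1)
    (V : S → ℝ) (Q : S → A → ℝ) (hVQ : IsValueFun P π r γ V Q)
    (V' : S → ℝ) (Q' : S → A → ℝ) (hVQ' : IsValueFun P π' r γ V' Q')
    (α ε : ℝ)
    (hα : α = ⨆ s : S, (1 / 2) * ∑ a : A, |π' s a - π s a|)
    (hε : ε = ⨆ p : S × A, |(π' p.1 p.2 / π p.1 p.2 - 1) * (Q p.1 p.2 - V p.1)|)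
    (s : S) :
    V' s ≥ V s +
      (∑' t : ℕ, γ ^ t * ∑ s' : S, (Mmat P π ^ t) s s' *
        ∑ a : A, (π' s' a - π s' a) * (Q s' a - V s')) -
      2 * α * γ * ε / (1 - γ) ^ 2 := by
  have hM0 : ∀ (p : S → A → ℝ), IsPolicy p → ∀ s s', 0 ≤ Mmat P p s s' := fun p hp s s' =>
    Finset.sum_nonneg fun a _ => mul_nonneg (hp.1 s a) (hP.1 s a s')
  have hM1 : ∀ (p : S → A → ℝ), IsPolicy p → ∀ s, ∑ s', Mmat P p s s' = 1 := by
    intro p hp s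
    have := aux_Msum P p (fun _ => 1) s
    simpa [hP.2, hp.2] using this
  obtain ⟨g, hg⟩ : ∃ g : S → ℝ, ∀ s, g s = ∑ a : A, (π' s a - π s a) * (Q s a - V s) :=
    ⟨_, fun _ => rfl⟩
  simp only [← hg]
  have hεb : ∀ s a, |(π' s a / π s a - 1) * (Q s a - V s)| ≤ ε := by
    intro s a
    rw [hε]
    exact le_ciSup (f := fun p : S × A => |(π' p.1 p.2 / π p.1 p.2 - 1) * (Q p.1 p.2 - V p.1)|)
      (Set.finite_range _).bddAbove (s, a)
  have hαb : ∀ s, ∑ a : A, |π' s a - π s a| ≤ 2 * α := by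
    intro s
    have : (1 / 2) * ∑ a : A, |π' s a - π s a| ≤ α := by
      rw [hα]
      exact le_ciSup (f := fun s : S => (1 / 2) * ∑ a : A, |π' s a - π s a|)
        (Set.finite_range _).bddAbove s
    linarith
  have hgb : ∀ s, |g s| ≤ ε := by
    intro s
    have h : g s = ∑ a, π s a * ((π' s a / π s a - 1) * (Q s a - V s)) := by
      rw [hg]
      refine Finset.sum_congr rfl fun a _ => ?_
      have := (hpos s a).ne'
      field_simp
    rw [h]
    exact aux_avg _ _ _ (hπ.1 s) (hπ.2 s) (hεb s)
  have hε0 : 0 ≤ ε := (abs_nonneg _).trans (hgb s)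
  obtain ⟨f, hf⟩ : ∃ f : ℕ → S → ℝ, ∀ t s, f t s = ∑ s' : S, (Mmat P π ^ t) s s' * g s' :=
    ⟨_, fun _ _ => rfl⟩
  simp only [← hf]
  have hf0 : ∀ s, f 0 s = g s := by
    intro s
    simp [hf, Matrix.one_apply]
  have hfs : ∀ t s, f (t + 1) s = ∑ s', Mmat P π s s' * f t s' := by
    intro t s
    simp only [hf, pow_succ', Matrix.mul_apply, Finset.sum_mul, Finset.mul_sum]
    rw [Finset.sum_comm]
    simp only [mul_assoc]
  have hfb : ∀ t s, |f t s| ≤ ε := by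
    intro t
    induction t with
    | zero => intro s; rw [hf0]; exact hgb s
    | succ t ih =>
      intro s
      rw [hfs]
      exact aux_avg _ _ _ (hM0 π hπ s) (hM1 π hπ s) ih
  have hsum : ∀ s, Summable fun t => γ ^ t * f t s := by
    intro s
    refine Summable.of_norm_bounded ((summable_geometric_of_lt_one hγ0 hγ1).mul_right ε) ?_
    intro t
    rw [Real.norm_eq_abs, abs_mul, abs_of_nonneg (pow_nonneg hγ0 t)]
    exact mul_le_mul_of_nonneg_left (hfb t s) (pow_nonneg hγ0 t)
  obtain ⟨W, hW⟩ : ∃ W : S → ℝ, ∀ s, W s = ∑' t, γ ^ t * f t s := ⟨_, fun _ => rfl⟩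
  rw [← hW]
  have hWr : ∀ s, W s = g s + γ * ∑ s', Mmat P π s s' * W s' := by
    intro s
    rw [hW, (hsum s).tsum_eq_zero_add]
    simp only [pow_zero, one_mul, hf0]
    congr 1
    simp only [hW, ← tsum_mul_left]
    rw [← Summable.tsum_finsetSum (fun s' _ => (hsum s').mul_left _), ← tsum_mul_left]
    congr 1
    ext t
    rw [hfs, Finset.mul_sum, Finset.mul_sum]
    refine Finset.sum_congr rfl fun s' _ => ?_
    ring
  have hWb : ∀ s, |W s| ≤ ε / (1 - γ) :=
    aux_fix (Mmat P π) W g γ ε hγ0 hγ1 (hM0 π hπ) (hM1 π hπ) hWr hgb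
  have hD : ∀ s, V' s - V s = g s + γ * ∑ s', Mmat P π' s s' * (V' s' - V s') := by
    intro s
    rw [aux_Msum, hg]
    have e1 : ∑ a, π' s a * Q' s a - ∑ a, π' s a * Q s a
        = γ * ∑ a, π' s a * ∑ s', P s a s' * (V' s' - V s') := by
      rw [← Finset.sum_sub_distrib, Finset.mul_sum]
      refine Finset.sum_congr rfl fun a _ => ?_
      rw [hVQ'.1, hVQ.1]
      simp only [mul_sub, Finset.sum_sub_distrib]
      ring
    have e2 : ∑ a : A, (π' s a - π s a) * (Q s a - V s)
        = ∑ a, π' s a * Q s a - ∑ a, π s a * Q s a := by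
      simp only [sub_mul, mul_sub, Finset.sum_sub_distrib, ← Finset.sum_mul, hπ.2, hπ'.2]
      ring
    rw [← e1, e2, ← hVQ'.2, ← hVQ.2]
    ring
  have hc : ∀ s, |γ * (∑ s', Mmat P π' s s' * W s' - ∑ s', Mmat P π s s' * W s')|
      ≤ γ * (2 * α * (ε / (1 - γ))) := by
    intro s
    rw [abs_mul, abs_of_nonneg hγ0]
    refine mul_le_mul_of_nonneg_left ?_ hγ0
    rw [aux_Msum, aux_Msum, ← Finset.sum_sub_distrib]
    simp only [← sub_mul]
    refine (Finset.abs_sum_le_sum_abs _ _).trans ?_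
    calc _ ≤ ∑ a, |π' s a - π s a| * (ε / (1 - γ)) := by
          refine Finset.sum_le_sum fun a _ => ?_
          rw [abs_mul]
          exact mul_le_mul_of_nonneg_left
            (aux_avg _ _ _ (hP.1 s a) (hP.2 s a) hWb) (abs_nonneg _)
      _ ≤ _ := by
          rw [← Finset.sum_mul]
          exact mul_le_mul_of_nonneg_right (hαb s) (div_nonneg hε0 (by linarith))
  have hfin := aux_fix (Mmat P π') (fun s => V' s - V s - W s) _ γ _ hγ0 hγ1
    (hM0 π' hπ') (hM1 π' hπ') (fun s => by
      have h1 := hD s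
      have h2 := hWr s
      have h3 : ∑ s', Mmat P π' s s' * (V' s' - V s' - W s')
        = ∑ s', Mmat P π' s s' * (V' s' - V s') - ∑ s', Mmat P π' s s' * W s' := by
        rw [← Finset.sum_sub_distrib]
        refine Finset.sum_congr rfl fun s' _ => ?_
        ring
      show V' s - V s - W s =
        γ * (∑ s', Mmat P π' s s' * W s' - ∑ s', Mmat P π s s' * W s') + _
      rw [h3]
      linarith) hc s
  have h4 := (abs_le.mp hfin).1
  have h5 : γ * (2 * α * (ε / (1 - γ))) / (1 - γ) = 2 * α * γ * ε / (1 - γ) ^ 2 := by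
    have : (1 - γ) ≠ 0 := by linarith
    field_simp
  rw [h5] at h4
  linarith
end

section
/- Let π and π' be policies with π'(a|s) > 0 for all s,a, let r : S×A → ℝ be a reward and γ ∈ [0,1). Set α = max_s (1/2) Σ_a |π'(a|s) − π(a|s)| (the maximal total-variation distance) and ε' = max_{s,a} |(1 − π(a|s)/π'(a|s)) · A_π(s,a)|. Then for every state s: V_{π'}(s) ≥ V_π(s) + Σ_{t=0}^∞ γ^t Σ_{s'} (M_π^t)(s,s') Σ_a π(a|s')·(1 − π(a|s')/π'(a|s'))·A_π(s',a) − 2αε'/(1−γ)². -/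
open Finset

variable {S A : Type*} [Fintype S] [Fintype A] [DecidableEq S] [Nonempty S] [Nonempty A]

lemma aux_avg_s6 {ι : Type*} [Fintype ι] (p x : ι → ℝ) (hp : ∀ i, 0 ≤ p i) (h1 : ∑ i, p i = 1) (C : ℝ)
    (hx : ∀ i, |x i| ≤ C) : |∑ i, p i * x i| ≤ C := by
  calc |∑ i, p i * x i| ≤ ∑ i, |p i * x i| := Finset.abs_sum_le_sum_abs _ _
    _ ≤ ∑ i, p i * C := by
        apply Finset.sum_le_sum
        intro i _
        rw [abs_mul, abs_of_nonneg (hp i)]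
        exact mul_le_mul_of_nonneg_left (hx i) (hp i)
    _ = C := by rw [← Finset.sum_mul, h1, one_mul]

lemma aux_contr {ι : Type*} [Fintype ι] [Nonempty ι] (M : ι → ι → ℝ) (hM : ∀ i j, 0 ≤ M i j)
    (h1 : ∀ i, ∑ j, M i j = 1) (γ : ℝ) (h0 : 0 ≤ γ) (hγ : γ < 1) (X b : ι → ℝ) (B : ℝ)
    (hb : ∀ i, |b i| ≤ B) (hX : ∀ i, X i = b i + γ * ∑ j, M i j * X j) (i : ι) :
    |X i| ≤ B / (1 - γ) := by
  obtain ⟨m, hm⟩ := Finite.exists_max (fun i => |X i|)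
  refine (hm i).trans ?_
  have h2 := aux_avg_s6 (M m) X (hM m) (h1 m) |X m| hm
  have h3 : |X m| ≤ B + γ * |X m| := by
    calc |X m| = |b m + γ * ∑ j, M m j * X j| := by rw [← hX m]
      _ ≤ |b m| + |γ * ∑ j, M m j * X j| := abs_add_le _ _
      _ = |b m| + γ * |∑ j, M m j * X j| := by rw [abs_mul, abs_of_nonneg h0]
      _ ≤ _ := add_le_add (hb m) (mul_le_mul_of_nonneg_left h2 h0)
  rw [le_div_iff₀ (by linarith)]
  linarith

lemma aux_diff {ι : Type*} [Fintype ι] (p q x : ι → ℝ) (C a : ℝ) (hC : ∀ i, |x i| ≤ C) (h0 : 0 ≤ C)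
    (ha : (1 / 2) * ∑ i, |q i - p i| ≤ a) : |∑ i, (q i - p i) * x i| ≤ 2 * a * C := by
  calc |∑ i, (q i - p i) * x i| ≤ ∑ i, |(q i - p i) * x i| := Finset.abs_sum_le_sum_abs _ _
    _ ≤ ∑ i, |q i - p i| * C := by
        apply Finset.sum_le_sum
        intro i _
        rw [abs_mul]
        exact mul_le_mul_of_nonneg_left (hC i) (abs_nonneg _)
    _ = (∑ i, |q i - p i|) * C := by rw [← Finset.sum_mul]
    _ ≤ _ := mul_le_mul_of_nonneg_right (by linarith) h0

lemma aux_series {ι : Type*} [Fintype ι] [DecidableEq ι] (M : Matrix ι ι ℝ)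
    (hM : ∀ i j, 0 ≤ M i j)
    (h1 : ∀ i, ∑ j, M i j = 1) (γ : ℝ) (h0 : 0 ≤ γ) (hγ : γ < 1) (g : ι → ℝ) (C : ℝ)
    (hg : ∀ i, |g i| ≤ C) (i : ι) :
    (∑' t : ℕ, γ ^ t * ∑ j, (M ^ t) i j * g j) =
      g i + γ * ∑ k, M i k * (∑' t : ℕ, γ ^ t * ∑ j, (M ^ t) k j * g j) := by
  have hsucc : ∀ t i, ∑ j, (M ^ (t + 1)) i j * g j = ∑ k, M i k * ∑ j, (M ^ t) k j * g j := by
    intro t i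
    have : (M ^ (t + 1)).mulVec g = M.mulVec ((M ^ t).mulVec g) := by
      rw [Matrix.mulVec_mulVec, pow_succ']
    exact congrFun this i
  have hbd : ∀ t i, |∑ j, (M ^ t) i j * g j| ≤ C := by
    intro t
    induction t with
    | zero => intro i; simpa [Matrix.one_apply] using hg i
    | succ t ih => intro i; rw [hsucc]; exact aux_avg_s6 _ _ (hM i) (h1 i) C ih
  have hs : ∀ i, Summable (fun t : ℕ => γ ^ t * ∑ j, (M ^ t) i j * g j) := by
    intro i
    refine Summable.of_norm_bounded ((summable_geometric_of_lt_one h0 hγ).mul_right C) ?_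
    intro t
    rw [Real.norm_eq_abs, abs_mul, abs_of_nonneg (pow_nonneg h0 t)]
    exact mul_le_mul_of_nonneg_left (hbd t i) (pow_nonneg h0 t)
  rw [(hs i).tsum_eq_zero_add]
  congr 1
  · simp [Matrix.one_apply]
  · simp_rw [hsucc, ← tsum_mul_left]
    rw [← Summable.tsum_finsetSum (fun k _ => (hs k).mul_left (M i k)), ← tsum_mul_left]
    congr 1
    ext t
    rw [Finset.mul_sum, Finset.mul_sum]
    exact Finset.sum_congr rfl fun k _ => by ring

lemma aux_M (P : S → A → S → ℝ) (p : S → A → ℝ) (X : S → ℝ) (s : S) :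
    ∑ k, Mmat P p s k * X k = ∑ a, p s a * ∑ k, P s a k * X k := by
  simp only [Mmat, Matrix.of_apply, Finset.sum_mul, Finset.mul_sum]
  rw [Finset.sum_comm]
  exact Finset.sum_congr rfl fun _ _ => Finset.sum_congr rfl fun _ _ => by ring

lemma aux_stoch (P : S → A → S → ℝ) (hP : IsKernel P) (p : S → A → ℝ) (hp : IsPolicy p) :
    (∀ i j, 0 ≤ Mmat P p i j) ∧ ∀ i, ∑ j, Mmat P p i j = 1 := by
  refine ⟨fun i j => Finset.sum_nonneg fun a _ => mul_nonneg (hp.1 i a) (hP.1 i a j), fun i => ?_⟩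
  have := aux_M P p (fun _ => 1) i
  simpa [hP.2, hp.2] using this

/-- Trust-region lower bound (ratio form `1 − π/π'`, sampled from the old policy `π`):
`V_{π'}(s) ≥ V_π(s) + Σ_t γ^t Σ_{s'} (M_π^t)(s,s') Σ_a π(a|s')(1 − π(a|s')/π'(a|s')) A_π(s',a)
  − 2αε'/(1−γ)²`. -/
theorem trust_region_lower_bound_inverse_ratio
    (P : S → A → S → ℝ) (hP : IsKernel P)
    (π π' : S → A → ℝ) (hπ : IsPolicy π) (hπ' : IsPolicy π')
    (hpos' : ∀ s a, 0 < π' s a)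
    (r : S → A → ℝ) (γ : ℝ) (hγ0 : 0 ≤ γ) (hγ1 : γ < 1)
    (V : S → ℝ) (Q : S → A → ℝ) (hVQ : IsValueFun P π r γ V Q)
    (V' : S → ℝ) (Q' : S → A → ℝ) (hVQ' : IsValueFun P π' r γ V' Q')
    (α ε' : ℝ)
    (hα : α = ⨆ s : S, (1 / 2) * ∑ a : A, |π' s a - π s a|)
    (hε' : ε' = ⨆ p : S × A, |(1 - π p.1 p.2 / π' p.1 p.2) * (Q p.1 p.2 - V p.1)|)
    (s : S) :
    V' s ≥ V s +
      (∑' t : ℕ, γ ^ t * ∑ s' : S, (Mmat P π ^ t) s s' *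
        ∑ a : A, π s' a * (1 - π s' a / π' s' a) * (Q s' a - V s')) -
      2 * α * ε' / (1 - γ) ^ 2 := by
  have hαs : ∀ s, (1 / 2) * ∑ a : A, |π' s a - π s a| ≤ α := fun s => by
    rw [hα]; exact le_ciSup (f := fun s => (1 / 2) * ∑ a : A, |π' s a - π s a|)
      (Set.finite_range _).bddAbove s
  have hw : ∀ s a, |(1 - π s a / π' s a) * (Q s a - V s)| ≤ ε' := fun s a => by
    rw [hε']; exact le_ciSup
      (f := fun p : S × A => |(1 - π p.1 p.2 / π' p.1 p.2) * (Q p.1 p.2 - V p.1)|)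
      (Set.finite_range _).bddAbove (s, a)
  clear hα hε'
  have hε0 : 0 ≤ ε' := (abs_nonneg _).trans (hw s (Classical.arbitrary A))
  have h1γ : 0 < 1 - γ := by linarith
  simp only [mul_assoc (π _ _)]
  set w : S → A → ℝ := fun s a => (1 - π s a / π' s a) * (Q s a - V s) with hwdef
  change V' s ≥ V s + (∑' t : ℕ, γ ^ t * ∑ s' : S, (Mmat P π ^ t) s s' * ∑ a : A, π s' a * w s' a)
    - 2 * α * ε' / (1 - γ) ^ 2
  have hw' : ∀ s a, |w s a| ≤ ε' := hw
  have hg : ∀ s, |∑ a, π s a * w s a| ≤ ε' := fun s => aux_avg_s6 _ _ (hπ.1 s) (hπ.2 s) _ (hw' s)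
  obtain ⟨hM0, hM1⟩ := aux_stoch P hP π hπ
  obtain ⟨hM0', hM1'⟩ := aux_stoch P hP π' hπ'
  have hU := aux_series (Mmat P π) hM0 hM1 γ hγ0 hγ1 (fun s => ∑ a, π s a * w s a) ε' hg
  set U : S → ℝ := fun s =>
    ∑' t : ℕ, γ ^ t * ∑ s' : S, (Mmat P π ^ t) s s' * ∑ a : A, π s' a * w s' a with hUdef
  change ∀ i, U i = (∑ a, π i a * w i a) + γ * ∑ k, Mmat P π i k * U k at hU
  have hUb := aux_contr (Mmat P π) hM0 hM1 γ hγ0 hγ1 U _ ε' hg hU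
  have hC0 : 0 ≤ ε' / (1 - γ) := div_nonneg hε0 h1γ.le
  -- performance difference
  have hD : ∀ i, V' i - V i =
      (∑ a, π' i a * w i a) + γ * ∑ k, Mmat P π' i k * (V' k - V k) := by
    intro i
    have e1 : ∑ a, π' i a * w i a = ∑ a, π' i a * Q i a - V i := by
      have : ∀ a, π' i a * w i a = π' i a * Q i a - π i a * Q i a - π' i a * V i + π i a * V i := by
        intro a
        have := (hpos' i a).ne'
        simp only [hwdef]
        field_simp
        ring
      simp only [this, Finset.sum_add_distrib, Finset.sum_sub_distrib, ← Finset.sum_mul,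
        hπ.2, hπ'.2, ← hVQ.2 i]
      ring
    have e2 : V' i - ∑ a, π' i a * Q i a = γ * ∑ k, Mmat P π' i k * (V' k - V k) := by
      rw [hVQ'.2 i, aux_M, ← Finset.sum_sub_distrib, Finset.mul_sum]
      refine Finset.sum_congr rfl fun a _ => ?_
      rw [hVQ'.1, hVQ.1]
      simp only [mul_sub, Finset.sum_sub_distrib]
      ring
    rw [e1, ← e2]; ring
  have hfin := aux_contr (Mmat P π') hM0' hM1' γ hγ0 hγ1 (fun i => V' i - V i - U i)
    (fun i => (∑ a, (π' i a - π i a) * w i a) +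
      γ * ∑ a, (π' i a - π i a) * ∑ k, P i a k * U k)
    (2 * α * ε' + γ * (2 * α * (ε' / (1 - γ)))) (by
      intro i
      refine (abs_add_le _ _).trans (add_le_add ?_ ?_)
      · exact aux_diff _ _ _ _ _ (hw' i) hε0 (hαs i)
      · rw [abs_mul, abs_of_nonneg hγ0]
        refine mul_le_mul_of_nonneg_left ?_ hγ0
        exact aux_diff _ _ _ _ _
          (fun a => aux_avg_s6 _ _ (hP.1 i a) (hP.2 i a) _ hUb) hC0 (hαs i)) (by
      intro i
      have a1 := hD i
      have a2 := hU i
      rw [aux_M] at a2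
      have a3 : ∑ k, Mmat P π' i k * (V' k - V k - U k) =
        ∑ k, Mmat P π' i k * (V' k - V k) - ∑ a, π' i a * ∑ k, P i a k * U k := by
        rw [← aux_M, ← Finset.sum_sub_distrib]
        exact Finset.sum_congr rfl fun k _ => by ring
      rw [a3]
      simp only [sub_mul (π' _ _), Finset.sum_sub_distrib]
      linear_combination a1 - a2) s
  have e : (2 * α * ε' + γ * (2 * α * (ε' / (1 - γ)))) / (1 - γ) = 2 * α * ε' / (1 - γ) ^ 2 := by
    field_simp
    ring
  rw [e] at hfin
  have := (abs_le.1 hfin).1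
  change V' s ≥ V s + U s - _
  linarith
end

section
/- Let f : S → {0,1} be a safety indicator that is absorbing for P, let r : S×A → ℝ be a reward and γ ∈ [0,1]. For a trajectory τ = (s_0,a_0,…,a_{T−2},s_{T−1}) write R(τ) = Σ_{t=0}^{T−2} γ^t r(s_t,a_t) and f(τ) = ∏_{u=0}^{T−1} f(s_u). Then for every policy π and state s: Σ_τ P_π(τ | S_0=s) · R(τ) · f(τ) = E_π[ Σ_{t=0}^{T−2} γ^t r(S_t,A_t) · Q^c_{π,t}(S_t,A_t) | S_0 = s ]. -/
open Finset

variable {S A : Type*} [Fintype S] [Fintype A] [DecidableEq S] [Nonempty S] [Nonempty A]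

theorem sum_fin_cons_aux {X : Type*} [Fintype X] (n : ℕ) (F : (Fin (n+1) → X) → ℝ) :
    ∑ σ : Fin (n+1) → X, F σ = ∑ x : X, ∑ σ : Fin n → X, F (Fin.cons x σ) := by
  rw [← Fintype.sum_prod_type' (f := fun x (σ : Fin n → X) => F (Fin.cons x σ))]
  exact (Fintype.sum_equiv (Fin.consEquiv (fun _ : Fin (n+1) => X)) _ _ (fun p => rfl)).symm

theorem trajExp_succ_aux (P : S → A → S → ℝ) (π : S → A → ℝ) (n : ℕ) (s : S)
    (g : (Fin (n+1+1) → S) → (Fin (n+1) → A) → ℝ) :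
    trajExp P π (n+1) s g = ∑ a : A, ∑ s' : S, π s a * P s a s' *
      trajExp P π n s' (fun σ α => g (Fin.cons s σ) (Fin.cons a α)) := by
  unfold trajExp
  rw [sum_fin_cons_aux]
  simp_rw [sum_fin_cons_aux (X := A)]
  rw [Finset.sum_eq_single s]
  · simp only [Fin.cons_zero, if_true, Fin.prod_univ_succ, Fin.castSucc_zero, Fin.cons_succ,
      ← Fin.succ_castSucc]
    rw [Finset.sum_comm]
    refine Finset.sum_congr rfl fun a _ => ?_
    simp_rw [Finset.mul_sum]
    rw [Finset.sum_comm (s := (Finset.univ : Finset S))]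
    refine Finset.sum_congr rfl fun σ _ => ?_
    rw [Finset.sum_comm]
    refine Finset.sum_congr rfl fun α _ => ?_
    simp [mul_assoc]
  · intro b _ hb
    simp [hb]
  · simp

theorem trajExp_add_aux (P : S → A → S → ℝ) (π : S → A → ℝ) (n : ℕ) (s : S)
    (g h : (Fin (n+1) → S) → (Fin n → A) → ℝ) (c d : ℝ) :
    trajExp P π n s (fun σ α => c * g σ α + d * h σ α)
      = c * trajExp P π n s g + d * trajExp P π n s h := by
  unfold trajExp
  simp_rw [Finset.mul_sum, ← Finset.sum_add_distrib]
  refine Finset.sum_congr rfl fun σ _ => Finset.sum_congr rfl fun α _ => ?_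
  split_ifs <;> ring

theorem trajExp_one_aux (P : S → A → S → ℝ) (hP : IsKernel P)
    (π : S → A → ℝ) (hπ : IsPolicy π) (n : ℕ) : ∀ s : S,
    trajExp P π n s (fun _ _ => 1) = 1 := by
  induction n with
  | zero =>
    intro s
    unfold trajExp
    rw [sum_fin_cons_aux]
    simp
  | succ n ih =>
    intro s
    rw [trajExp_succ_aux]
    simp_rw [ih, mul_one, ← Finset.mul_sum, hP.2, mul_one, hπ.2]

theorem main_aux
    (P : S → A → S → ℝ) (hP : IsKernel P)
    (π : S → A → ℝ) (hπ : IsPolicy π)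
    (f : S → ℝ) (hf : ∀ s, f s = 0 ∨ f s = 1)
    (habs : ∀ s a s', 0 < P s a s' → f s' ≤ f s)
    (r : S → A → ℝ) (γ : ℝ) (n : ℕ) : ∀ s : S,
    trajExp P π n s (fun σ α =>
      (∑ t : Fin n, γ ^ (t : ℕ) * r (σ (Fin.castSucc t)) (α t)) *
        ∏ u : Fin (n + 1), f (σ u))
    = trajExp P π n s (fun σ α =>
        ∑ t : Fin n, γ ^ (t : ℕ) * r (σ (Fin.castSucc t)) (α t) *
          Qc f P π (n - (t : ℕ)) (σ (Fin.castSucc t)) (α t)) := by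
  induction n with
  | zero => intro s; simp
  | succ n ih =>
    intro s
    rw [trajExp_succ_aux, trajExp_succ_aux]
    refine Finset.sum_congr rfl fun a _ => ?_
    have hz : ∀ s', f s' = 0 → trajExp P π n s' (fun σ α =>
      (∑ t : Fin n, γ ^ (t : ℕ) * r (σ (Fin.castSucc t)) (α t)) *
        ∏ u : Fin (n + 1), f (σ u)) = 0 := by
      intro s' h
      unfold trajExp
      refine Finset.sum_eq_zero fun σ _ => Finset.sum_eq_zero fun α _ => ?_
      split_ifs with h0
      · have h1 : ∏ u : Fin (n + 1), f (σ u) = 0 :=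
          Finset.prod_eq_zero (Finset.mem_univ 0) (by rw [h0, h])
        simp only [h1, mul_zero]
      · rfl
    have hL : ∀ s', trajExp P π n s' (fun σ α =>
        (∑ t : Fin (n+1), γ ^ (t : ℕ) * r ((Fin.cons s σ : Fin (n+1+1) → S) (Fin.castSucc t))
          ((Fin.cons a α : Fin (n+1) → A) t)) *
          ∏ u : Fin (n + 1 + 1), f ((Fin.cons s σ : Fin (n+1+1) → S) u))
        = (r s a * f s) * Vc f P π n s' + (γ * f s) * trajExp P π n s' (fun σ α =>
      (∑ t : Fin n, γ ^ (t : ℕ) * r (σ (Fin.castSucc t)) (α t)) *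
        ∏ u : Fin (n + 1), f (σ u)) := by
      intro s'
      unfold Vc
      rw [← trajExp_add_aux]
      congr 1
      funext σ α
      rw [Fin.sum_univ_succ, Fin.prod_univ_succ]
      simp only [Fin.cons_zero, Fin.castSucc_zero, Fin.cons_succ, ← Fin.succ_castSucc,
        Fin.val_zero, Fin.val_succ, pow_succ', pow_zero, mul_assoc, ← Finset.mul_sum]
      ring
    have hR : ∀ s', trajExp P π n s' (fun σ α =>
        ∑ t : Fin (n+1), γ ^ (t : ℕ) * r ((Fin.cons s σ : Fin (n+1+1) → S) (Fin.castSucc t))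
          ((Fin.cons a α : Fin (n+1) → A) t) *
          Qc f P π (n + 1 - (t : ℕ)) ((Fin.cons s σ : Fin (n+1+1) → S) (Fin.castSucc t))
          ((Fin.cons a α : Fin (n+1) → A) t))
        = (r s a * Qc f P π (n+1) s a) * 1 + γ * trajExp P π n s' (fun σ α =>
        ∑ t : Fin n, γ ^ (t : ℕ) * r (σ (Fin.castSucc t)) (α t) *
          Qc f P π (n - (t : ℕ)) (σ (Fin.castSucc t)) (α t)) := by
      intro s'
      rw [← trajExp_one_aux P hP π hπ n s', ← trajExp_add_aux]
      congr 1
      funext σ α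
      rw [Fin.sum_univ_succ]
      simp only [Fin.cons_zero, Fin.castSucc_zero, Fin.cons_succ, ← Fin.succ_castSucc,
        Fin.val_zero, Fin.val_succ, pow_succ', pow_zero, mul_assoc, ← Finset.mul_sum,
        Nat.add_sub_add_right, Nat.sub_zero]
      ring
    simp_rw [hL, hR, ← ih, mul_add, Finset.sum_add_distrib]
    congr 1
    · rw [← Finset.sum_mul, ← Finset.mul_sum, hP.2]
      simp only [Qc, Finset.mul_sum, Finset.sum_mul]
      refine Finset.sum_congr rfl fun s' _ => ?_
      ring
    · refine Finset.sum_congr rfl fun s' _ => ?_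
      rcases hf s with h | h
      · rcases (hP.1 s a s').eq_or_lt with h0 | h0
        · rw [← h0]; ring
        · have h1 := habs s a s' h0
          have h2 : f s' = 0 := by
            rcases hf s' with h3 | h3
            · exact h3
            · rw [h, h3] at h1; norm_num at h1
          rw [hz s' h2]; ring
      · rw [h]; ring

/-- Canceling unsafe rewards: for an absorbing safety indicator,
`Σ_τ P_π(τ|S_0=s) · R(τ) · f(τ) = E_π[ Σ_{t=0}^{T−2} γ^t r(S_t,A_t) · Q^c_{π,t}(S_t,A_t) | S_0 = s ]`. -/
theorem canceled_return_eq_safety_weighted_return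
    (P : S → A → S → ℝ) (hP : IsKernel P)
    (π : S → A → ℝ) (hπ : IsPolicy π)
    (f : S → ℝ) (hf : ∀ s, f s = 0 ∨ f s = 1)
    (habs : ∀ s a s', 0 < P s a s' → f s' ≤ f s)
    (r : S → A → ℝ) (γ : ℝ) (hγ0 : 0 ≤ γ) (hγ1 : γ ≤ 1)
    (T : ℕ) (hT : 2 ≤ T) (s : S) :
    trajExp P π (T - 1) s (fun σ α =>
      (∑ t : Fin (T - 1), γ ^ (t : ℕ) * r (σ (Fin.castSucc t)) (α t)) *
        ∏ u : Fin (T - 1 + 1), f (σ u))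
    = trajExp P π (T - 1) s (fun σ α =>
        ∑ t : Fin (T - 1), γ ^ (t : ℕ) * r (σ (Fin.castSucc t)) (α t) *
          Qc f P π (T - 1 - (t : ℕ)) (σ (Fin.castSucc t)) (α t)) := by
  exact main_aux P hP π hπ f hf habs r γ (T - 1) s
end

section
/- Let r̃ : S×A → ℝ be any reward function (in particular r̃(s,a) = r(s,a)·q(s,a)^k for a reward r, a fixed function q : S×A → [0,1], and k ∈ ℕ), let γ ∈ [0,1), and let π and π' be policies with π(a|s) > 0 for all s,a. Set α = max_s (1/2) Σ_a |π'(a|s) − π(a|s)| and ε = max_{s,a} |(π'(a|s)/π(a|s) − 1) · A^{r̃}_π(s,a)|, and define V̄^{r̃}_{π'}(s) := Σ_{t=0}^∞ γ^t Σ_{s'} (M_{π'}^t)(s,s') Σ_a π'(a|s') r̃(s',a). Then for every state s: V̄^{r̃}_{π'}(s) ≥ V^{r̃}_π(s) + Σ_{t=0}^∞ γ^t Σ_{s'} (M_π^t)(s,s') Σ_a (π'(a|s') − π(a|s')) A^{r̃}_π(s',a) − 2αγε/(1−γ)². -/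
open Finset

variable {S A : Type*} [Fintype S] [Fintype A] [DecidableEq S] [Nonempty S] [Nonempty A]

lemma aux_step {S : Type*} [Fintype S] (M : Matrix S S ℝ) (h0 : ∀ s s', 0 ≤ M s s')
    (h1 : ∀ s, ∑ s', M s s' = 1) (f : S → ℝ) (c : ℝ) (hf : ∀ s, |f s| ≤ c) (s : S) :
    |(M.mulVec f) s| ≤ c := by
  calc |(M.mulVec f) s| = |∑ s', M s s' * f s'| := rfl
    _ ≤ ∑ s', |M s s' * f s'| := Finset.abs_sum_le_sum_abs _ _
    _ ≤ ∑ s', M s s' * c := by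
        refine Finset.sum_le_sum fun s' _ => ?_
        rw [abs_mul, abs_of_nonneg (h0 s s')]
        exact mul_le_mul_of_nonneg_left (hf s') (h0 s s')
    _ = c := by rw [← Finset.sum_mul, h1, one_mul]

lemma aux_pow {S : Type*} [Fintype S] [DecidableEq S] (M : Matrix S S ℝ) (h0 : ∀ s s', 0 ≤ M s s')
    (h1 : ∀ s, ∑ s', M s s' = 1) (f : S → ℝ) (c : ℝ) (hf : ∀ s, |f s| ≤ c) (t : ℕ) (s : S) :
    |((M ^ t).mulVec f) s| ≤ c := by
  induction t generalizing s with
  | zero => simpa using hf s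
  | succ t ih =>
    rw [pow_succ', ← Matrix.mulVec_mulVec]
    exact aux_step M h0 h1 _ c ih s

lemma aux_diff_s10 {S : Type*} [Fintype S] [DecidableEq S] (M N : Matrix S S ℝ)
    (h0 : ∀ s s', 0 ≤ M s s') (h1 : ∀ s, ∑ s', M s s' = 1)
    (k0 : ∀ s s', 0 ≤ N s s') (k1 : ∀ s, ∑ s', N s s' = 1) (d : ℝ)
    (hd : ∀ s, ∑ s', |N s s' - M s s'| ≤ d)
    (f : S → ℝ) (c : ℝ) (hc : 0 ≤ c) (hf : ∀ s, |f s| ≤ c) (t : ℕ) (s : S) :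
    |((N ^ t).mulVec f) s - ((M ^ t).mulVec f) s| ≤ t * (d * c) := by
  induction t generalizing s with
  | zero => simp
  | succ t ih =>
    have e : ((N ^ (t+1)).mulVec f) s - ((M ^ (t+1)).mulVec f) s
        = (N.mulVec ((N ^ t).mulVec f - (M ^ t).mulVec f)) s
          + ∑ s', (N s s' - M s s') * ((M ^ t).mulVec f) s' := by
      have : ∑ s', (N s s' - M s s') * ((M ^ t).mulVec f) s'
          = (N.mulVec ((M ^ t).mulVec f)) s - (M.mulVec ((M ^ t).mulVec f)) s := by
        simp only [sub_mul, Finset.sum_sub_distrib]; rfl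
      rw [this, Matrix.mulVec_sub, pow_succ', pow_succ', ← Matrix.mulVec_mulVec,
        ← Matrix.mulVec_mulVec, Pi.sub_apply]
      ring
    rw [e]
    have a1 := aux_step N k0 k1 ((N ^ t).mulVec f - (M ^ t).mulVec f) _ ih s
    have a2 : |∑ s', (N s s' - M s s') * ((M ^ t).mulVec f) s'| ≤ d * c := by
      calc _ ≤ ∑ s', |(N s s' - M s s') * ((M ^ t).mulVec f) s'| :=
            Finset.abs_sum_le_sum_abs _ _
        _ ≤ ∑ s', |N s s' - M s s'| * c := by
            refine Finset.sum_le_sum fun s' _ => ?_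
            rw [abs_mul]
            exact mul_le_mul_of_nonneg_left (aux_pow M h0 h1 f c hf t s') (abs_nonneg _)
        _ = (∑ s', |N s s' - M s s'|) * c := by rw [Finset.sum_mul]
        _ ≤ d * c := mul_le_mul_of_nonneg_right (hd s) hc
    refine (abs_add_le _ _).trans ?_
    push_cast
    linarith

lemma aux_summable {S : Type*} [Fintype S] [DecidableEq S] (M : Matrix S S ℝ)
    (h0 : ∀ s s', 0 ≤ M s s') (h1 : ∀ s, ∑ s', M s s' = 1) (f : S → ℝ)
    (γ : ℝ) (hγ0 : 0 ≤ γ) (hγ1 : γ < 1) (s : S) :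
    Summable fun t : ℕ => γ ^ t * ((M ^ t).mulVec f) s := by
  have hf : ∀ s, |f s| ≤ ∑ s', |f s'| := fun s =>
    Finset.single_le_sum (f := fun s => |f s|) (fun i _ => abs_nonneg _) (Finset.mem_univ s)
  refine Summable.of_norm_bounded
    ((summable_geometric_of_lt_one hγ0 hγ1).mul_right (∑ s', |f s'|)) fun t => ?_
  rw [Real.norm_eq_abs, abs_mul, abs_of_nonneg (pow_nonneg hγ0 t)]
  exact mul_le_mul_of_nonneg_left (aux_pow M h0 h1 f _ hf t s) (pow_nonneg hγ0 t)

lemma aux_tele {S : Type*} [Fintype S] [DecidableEq S] (M : Matrix S S ℝ)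
    (h0 : ∀ s s', 0 ≤ M s s') (h1 : ∀ s, ∑ s', M s s' = 1) (r g V : S → ℝ)
    (γ : ℝ) (hγ0 : 0 ≤ γ) (hγ1 : γ < 1) (hg : r = g + V - γ • M.mulVec V) (s : S) :
    ∑' t : ℕ, γ ^ t * ((M ^ t).mulVec r) s
      = V s + ∑' t : ℕ, γ ^ t * ((M ^ t).mulVec g) s := by
  have sg := aux_summable M h0 h1 g γ hγ0 hγ1 s
  have sV := aux_summable M h0 h1 V γ hγ0 hγ1 s
  have sV' := (summable_nat_add_iff 1).2 sV
  have e : ∀ t : ℕ, γ ^ t * ((M ^ t).mulVec r) s = γ ^ t * ((M ^ t).mulVec g) s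
      + (γ ^ t * ((M ^ t).mulVec V) s - γ ^ (t+1) * ((M ^ (t+1)).mulVec V) s) := by
    intro t
    rw [hg, Matrix.mulVec_sub, Matrix.mulVec_add, Matrix.mulVec_smul, pow_succ M,
      ← Matrix.mulVec_mulVec]
    simp only [Pi.sub_apply, Pi.add_apply, Pi.smul_apply, smul_eq_mul]
    ring
  rw [tsum_congr e, sg.tsum_add (sV.sub sV'), sV.tsum_sub sV', sV.tsum_eq_zero_add]
  simp
  ring

lemma aux_M_s10 (S A : Type*) [Fintype S] [Fintype A] (P : S → A → S → ℝ) (hP : IsKernel P)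
    (π : S → A → ℝ) (hπ : IsPolicy π) :
    (∀ s s', 0 ≤ Mmat P π s s') ∧ ∀ s, ∑ s', Mmat P π s s' = 1 := by
  constructor
  · intro s s'
    exact Finset.sum_nonneg fun a _ => mul_nonneg (hπ.1 s a) (hP.1 s a s')
  · intro s
    simp only [Mmat, Matrix.of_apply]
    rw [Finset.sum_comm]
    simp only [← Finset.mul_sum, hP.2, mul_one, hπ.2]

lemma aux_main {S : Type*} [Fintype S] [DecidableEq S] (M N : Matrix S S ℝ)
    (m0 : ∀ s s', 0 ≤ M s s') (m1 : ∀ s, ∑ s', M s s' = 1)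
    (n0 : ∀ s s', 0 ≤ N s s') (n1 : ∀ s, ∑ s', N s s' = 1) (r g V : S → ℝ)
    (γ : ℝ) (hγ0 : 0 ≤ γ) (hγ1 : γ < 1) (hr : r = g + V - γ • N.mulVec V) (α ε : ℝ)
    (hd : ∀ s, ∑ s', |N s s' - M s s'| ≤ 2 * α) (hε0 : 0 ≤ ε) (hg : ∀ s, |g s| ≤ ε) (s : S) :
    (∑' t : ℕ, γ ^ t * ∑ s', (N ^ t) s s' * r s') ≥
      V s + (∑' t : ℕ, γ ^ t * ∑ s', (M ^ t) s s' * g s') - 2 * α * γ * ε / (1 - γ) ^ 2 := by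
  change (∑' t : ℕ, γ ^ t * ((N ^ t).mulVec r) s) ≥
    V s + (∑' t : ℕ, γ ^ t * ((M ^ t).mulVec g) s) - 2 * α * γ * ε / (1 - γ) ^ 2
  rw [aux_tele N n0 n1 r g V γ hγ0 hγ1 hr s]
  have sN := aux_summable N n0 n1 g γ hγ0 hγ1 s
  have sM := aux_summable M m0 m1 g γ hγ0 hγ1 s
  have hn : ‖γ‖ < 1 := by rw [Real.norm_eq_abs, abs_of_nonneg hγ0]; exact hγ1
  have hs : HasSum (fun t : ℕ => (t : ℝ) * γ ^ t * (2 * α * ε)) (γ / (1 - γ) ^ 2 * (2 * α * ε)) :=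
    (hasSum_coe_mul_geometric_of_norm_lt_one hn).mul_right _
  have key : ∑' t : ℕ, γ ^ t * ((M ^ t).mulVec g) s - ∑' t : ℕ, γ ^ t * ((N ^ t).mulVec g) s
      ≤ γ / (1 - γ) ^ 2 * (2 * α * ε) := by
    rw [← sM.tsum_sub sN, ← hs.tsum_eq]
    refine Summable.tsum_le_tsum (fun t => ?_) (sM.sub sN) hs.summable
    have := (abs_le.1 (aux_diff_s10 M N m0 m1 n0 n1 _ hd g ε hε0 hg t s)).1
    have h2 := mul_le_mul_of_nonneg_left this (pow_nonneg hγ0 t)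
    linarith
  have e : 2 * α * γ * ε / (1 - γ) ^ 2 = γ / (1 - γ) ^ 2 * (2 * α * ε) := by ring
  rw [e]
  linarith

/-- Trust-region lower bound for the surrogate objective
`V̄^{r̃}_{π'}(s) = Σ_t γ^t Σ_{s'} (M_{π'}^t)(s,s') Σ_a π'(a|s') r̃(s',a)`:
`V̄^{r̃}_{π'}(s) ≥ V^{r̃}_π(s) + Σ_t γ^t Σ_{s'} (M_π^t)(s,s') Σ_a (π'(a|s') − π(a|s')) A^{r̃}_π(s',a)
  − 2αγε/(1−γ)²`. -/
theorem surrogate_trust_region_lower_bound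
    (P : S → A → S → ℝ) (hP : IsKernel P)
    (π π' : S → A → ℝ) (hπ : IsPolicy π) (hπ' : IsPolicy π')
    (hpos : ∀ s a, 0 < π s a)
    (rt : S → A → ℝ) (γ : ℝ) (hγ0 : 0 ≤ γ) (hγ1 : γ < 1)
    (V : S → ℝ) (Q : S → A → ℝ) (hVQ : IsValueFun P π rt γ V Q)
    (α ε : ℝ)
    (hα : α = ⨆ s : S, (1 / 2) * ∑ a : A, |π' s a - π s a|)
    (hε : ε = ⨆ p : S × A, |(π' p.1 p.2 / π p.1 p.2 - 1) * (Q p.1 p.2 - V p.1)|)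
    (s : S) :
    (∑' t : ℕ, γ ^ t * ∑ s' : S, (Mmat P π' ^ t) s s' *
        ∑ a : A, π' s' a * rt s' a)
    ≥ V s +
      (∑' t : ℕ, γ ^ t * ∑ s' : S, (Mmat P π ^ t) s s' *
        ∑ a : A, (π' s' a - π s' a) * (Q s' a - V s')) -
      2 * α * γ * ε / (1 - γ) ^ 2 := by
  obtain ⟨m0, m1⟩ := aux_M_s10 S A P hP π hπ
  obtain ⟨n0, n1⟩ := aux_M_s10 S A P hP π' hπ'
  obtain ⟨g, hgdef⟩ : ∃ g : S → ℝ, g = fun s' => ∑ a : A, (π' s' a - π s' a) * (Q s' a - V s') := ⟨_, rfl⟩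
  obtain ⟨r, hrdef⟩ : ∃ r : S → ℝ, r = fun s' => ∑ a : A, π' s' a * rt s' a := ⟨_, rfl⟩
  have hαs : ∀ s, ∑ a : A, |π' s a - π s a| ≤ 2 * α := by
    intro s
    have := le_ciSup (f := fun s : S => (1 / 2) * ∑ a : A, |π' s a - π s a|)
      (Set.finite_range _).bddAbove s
    rw [← hα] at this
    linarith
  have hεs : ∀ s a, |(π' s a / π s a - 1) * (Q s a - V s)| ≤ ε := by
    intro s a
    have := le_ciSup
      (f := fun p : S × A => |(π' p.1 p.2 / π p.1 p.2 - 1) * (Q p.1 p.2 - V p.1)|)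
      (Set.finite_range _).bddAbove (s, a)
    rw [← hε] at this
    exact this
  have hε0 : 0 ≤ ε := (abs_nonneg _).trans (hεs s (Classical.arbitrary A))
  have hg : ∀ s, |g s| ≤ ε := by
    intro s
    rw [hgdef]
    calc _ ≤ ∑ a, |(π' s a - π s a) * (Q s a - V s)| := Finset.abs_sum_le_sum_abs _ _
      _ ≤ ∑ a, π s a * ε := by
          refine Finset.sum_le_sum fun a _ => ?_
          have e : (π' s a - π s a) * (Q s a - V s)
              = π s a * ((π' s a / π s a - 1) * (Q s a - V s)) := by
            have := (hpos s a).ne'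
            field_simp
          rw [e, abs_mul, abs_of_pos (hpos s a)]
          exact mul_le_mul_of_nonneg_left (hεs s a) (hpos s a).le
      _ = ε := by rw [← Finset.sum_mul, hπ.2, one_mul]
  have hd : ∀ s, ∑ s', |Mmat P π' s s' - Mmat P π s s'| ≤ 2 * α := by
    intro s
    refine le_trans ?_ (hαs s)
    calc ∑ s', |Mmat P π' s s' - Mmat P π s s'| ≤ ∑ s', ∑ a, |π' s a - π s a| * P s a s' := by
          refine Finset.sum_le_sum fun s' _ => ?_
          have e : Mmat P π' s s' - Mmat P π s s' = ∑ a, (π' s a - π s a) * P s a s' := by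
            simp only [Mmat, Matrix.of_apply, sub_mul, Finset.sum_sub_distrib]
          rw [e]
          refine (Finset.abs_sum_le_sum_abs _ _).trans (le_of_eq ?_)
          refine Finset.sum_congr rfl fun a _ => ?_
          rw [abs_mul, abs_of_nonneg (hP.1 s a s')]
      _ = ∑ a, |π' s a - π s a| := by
          rw [Finset.sum_comm]
          simp only [← Finset.mul_sum, hP.2, mul_one]
  have hr : r = g + V - γ • (Mmat P π').mulVec V := by
    funext s
    have e1 : ((Mmat P π').mulVec V) s = ∑ a, π' s a * ∑ s', P s a s' * V s' := by
      change ∑ s', (∑ a, π' s a * P s a s') * V s' = _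
      simp only [Finset.sum_mul, Finset.mul_sum]
      rw [Finset.sum_comm]
      simp only [mul_assoc]
    have e2 : g s = ∑ a, π' s a * Q s a - V s := by
      have : ∀ a, (π' s a - π s a) * (Q s a - V s)
          = π' s a * Q s a - π s a * Q s a - (π' s a * V s - π s a * V s) := fun a => by ring
      simp only [hgdef, this, Finset.sum_sub_distrib, ← Finset.sum_mul, hπ.2, hπ'.2]
      rw [← hVQ.2 s]
      ring
    have e3 : ∑ a, π' s a * Q s a = r s + γ * ∑ a, π' s a * ∑ s', P s a s' * V s' := by
      rw [hrdef, Finset.mul_sum, ← Finset.sum_add_distrib]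
      refine Finset.sum_congr rfl fun a _ => ?_
      rw [hVQ.1 s a]
      ring
    simp only [Pi.sub_apply, Pi.add_apply, Pi.smul_apply, smul_eq_mul]
    rw [e1, e2, e3]
    ring
  have := aux_main (Mmat P π) (Mmat P π') m0 m1 n0 n1 r g V γ hγ0 hγ1 hr α ε hd hε0 hg s
  rw [hgdef, hrdef] at this
  exact this
end
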